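/- arXiv:2511.11779 — 2 statements merged into one kernel-verified Lean document; each statement's English description precedes it below -/
import Mathlib

section
/- The constant m/(2+m) in the improved Bohr theorem is best possible: for every m ∈ (0,1], every N ≥ 1, every d₁, …, d_N ≥ 0 satisfying 8 d₁ M_m² + ∑_{k=2}^N 2(2k−1) c_k d_k M_m^{2k} ≤ m (with M_m = m(2+m)/(4(m+1)) and c_k = max_{x∈[0,1]} x(1+x)²(1−x²)^{2k−2}), and every r with m/(2+m) < r < 1, there exist a function f(q) = ∑_{k=0}^∞ qᵏ pₖ ∈ SB(𝔹), functions ωₖ ∈ SB_k(𝔹) for k ≥ 1, and a point q ∈ 𝔹 with |q| = r such that |p₀|^m + ∑_{k=1}^∞ |ωₖ(q)| |pₖ| + ∑_{i=1}^N d_i (S*_q)^i > 1. -/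
noncomputable section
open scoped Quaternion

/-- Value of the slice regular function with Taylor coefficients `p` at `q`. -/
noncomputable def sliceVal (p : ℕ → ℍ[ℝ]) (q : ℍ[ℝ]) : ℍ[ℝ] := ∑' k : ℕ, q ^ k * p k

/-- The power series with coefficients `p` converges on the open unit ball. -/
def SliceRegOn (p : ℕ → ℍ[ℝ]) : Prop :=
  ∀ q : ℍ[ℝ], ‖q‖ < 1 → Summable fun k : ℕ => q ^ k * p k

/-- The class `SB(𝔹)` of slice regular self-maps of the unit ball. -/
def SBClass (p : ℕ → ℍ[ℝ]) : Prop :=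
  SliceRegOn p ∧ ∀ q : ℍ[ℝ], ‖q‖ < 1 → ‖sliceVal p q‖ < 1

/-- The class `SB_n(𝔹)`: members of `SB(𝔹)` whose Taylor coefficients of order
`0, …, n-1` vanish and whose `n`-th Taylor coefficient is nonzero. -/
def SBnClass (n : ℕ) (p : ℕ → ℍ[ℝ]) : Prop :=
  SBClass p ∧ (∀ j, j < n → p j = 0) ∧ p n ≠ 0

/-- `c_k = max_{x ∈ [0,1]} x (1+x)² (1−x²)^{2k−2}`. -/
noncomputable def cmax (k : ℕ) : ℝ :=
  sSup ((fun x : ℝ => x * (1 + x) ^ 2 * (1 - x ^ 2) ^ (2 * k - 2)) '' Set.Icc 0 1)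

/-- `M_m = m(2+m)/(4(m+1))`. -/
noncomputable def Mconst (m : ℝ) : ℝ := m * (2 + m) / (4 * (m + 1))

/-- The quantity `S*_q = ∑_{k≥1} k |q|^{2k} |p_k|²`. -/
noncomputable def Sstar (p : ℕ → ℍ[ℝ]) (q : ℍ[ℝ]) : ℝ :=
  ∑' k : ℕ, ((k : ℝ) + 1) * ‖q‖ ^ (2 * (k + 1)) * ‖p (k + 1)‖ ^ 2

/-- Taylor coefficients of the Moebius map `(a - q) (1 - a q)⁻¹`. -/
def mobC (a : ℝ) : ℕ → ℍ[ℝ]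
  | 0 => (a : ℍ[ℝ])
  | (k + 1) => ((-(1 - a ^ 2) * a ^ k : ℝ) : ℍ[ℝ])

/-- Taylor coefficients of the monomial `q ^ n`. -/
def monC (n : ℕ) (j : ℕ) : ℍ[ℝ] := if j = n then 1 else 0

lemma monC_hasSum (n : ℕ) (q : ℍ[ℝ]) : HasSum (fun k : ℕ => q ^ k * monC n k) (q ^ n) := by
  have := hasSum_single (f := fun k : ℕ => q ^ k * monC n k) n (by
    intro b hb
    simp [monC, hb])
  simpa [monC] using this

lemma monC_SBn (n : ℕ) (hn : 1 ≤ n) : SBnClass n (monC n) := by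
  refine ⟨⟨fun q _ => (monC_hasSum n q).summable, fun q hq => ?_⟩, ?_, ?_⟩
  · rw [sliceVal, (monC_hasSum n q).tsum_eq, norm_pow]
    exact pow_lt_one₀ (norm_nonneg _) hq (by omega)
  · intro j hj
    simp [monC, hj.ne]
  · simp [monC]

lemma mob_norm (a : ℝ) (ha0 : 0 < a) (ha1 : a < 1) (q : ℍ[ℝ]) (hq : ‖q‖ < 1) :
    ‖(a : ℍ[ℝ]) - q‖ < ‖1 - (a : ℍ[ℝ]) * q‖ := by
  have h1 : ‖q‖ * ‖q‖ < 1 := by nlinarith [norm_nonneg q]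
  apply lt_of_mul_self_lt_mul_self₀ (norm_nonneg _)
  rw [← Quaternion.normSq_eq_norm_mul_self] at h1 ⊢
  rw [← Quaternion.normSq_eq_norm_mul_self]
  rw [Quaternion.normSq_def'] at h1 ⊢
  rw [Quaternion.normSq_def']
  simp
  have ha : 0 < 1 - a ^ 2 := by nlinarith
  nlinarith [mul_pos ha (sub_pos.2 h1)]

lemma mobC_hasSum (a : ℝ) (ha0 : 0 < a) (ha1 : a < 1) (q : ℍ[ℝ]) (hq : ‖q‖ < 1) :
    HasSum (fun k : ℕ => q ^ k * mobC a k)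
      (((a : ℍ[ℝ]) - q) * (1 - (a : ℍ[ℝ]) * q)⁻¹) := by
  have hn : ‖(a : ℍ[ℝ]) * q‖ < 1 := by
    rw [norm_mul, Quaternion.norm_coe, Real.norm_of_nonneg ha0.le]
    nlinarith [norm_nonneg q]
  have hne : (1 - (a : ℍ[ℝ]) * q) ≠ 0 := by
    intro h
    rw [sub_eq_zero] at h
    rw [← h] at hn
    simp at hn
  have hc : (a : ℍ[ℝ]) * q = q * a := Quaternion.coe_commutes a q
  have h := ((hasSum_geometric_of_norm_lt_one hn).mul_left (((-(1 - a ^ 2) : ℝ) : ℍ[ℝ]) * q))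
  have h2 : HasSum (fun k : ℕ => q ^ (k + 1) * mobC a (k + 1))
      (((-(1 - a ^ 2) : ℝ) : ℍ[ℝ]) * q * (1 - (a : ℍ[ℝ]) * q)⁻¹) := by
    suffices hfun : (fun k : ℕ => q ^ (k + 1) * mobC a (k + 1)) =
        fun k : ℕ => ((-(1 - a ^ 2) : ℝ) : ℍ[ℝ]) * q * ((a : ℍ[ℝ]) * q) ^ k by
      rw [hfun]
      exact h
    funext k
    have hcm : Commute (a : ℍ[ℝ]) q := hc
    rw [hcm.mul_pow]
    simp only [mobC]
    rw [← Quaternion.coe_commutes, Quaternion.coe_mul, Quaternion.coe_pow, pow_succ' q k]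
    have hc2 : (a : ℍ[ℝ]) ^ k * q = q * (a : ℍ[ℝ]) ^ k := hcm.pow_left k
    simp only [mul_assoc]
    rw [← mul_assoc ((a : ℍ[ℝ]) ^ k) q, hc2, mul_assoc]
  have h3 := (hasSum_nat_add_iff (f := fun k : ℕ => q ^ k * mobC a k) 1).1 h2
  suffices hval : ((a : ℍ[ℝ]) - q) * (1 - (a : ℍ[ℝ]) * q)⁻¹ =
      ((-(1 - a ^ 2) : ℝ) : ℍ[ℝ]) * q * (1 - (a : ℍ[ℝ]) * q)⁻¹ +
        ∑ i ∈ Finset.range 1, q ^ i * mobC a i by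
    rw [hval]
    exact h3
  rw [← mul_inv_cancel_right₀ hne (∑ i ∈ Finset.range 1, q ^ i * mobC a i), ← add_mul]
  congr 1
  simp [mobC, mul_sub, sub_mul]
  rw [pow_two, mul_assoc]
  abel

lemma mobC_SB (a : ℝ) (ha0 : 0 < a) (ha1 : a < 1) : SBClass (mobC a) := by
  refine ⟨fun q hq => (mobC_hasSum a ha0 ha1 q hq).summable, fun q hq => ?_⟩
  rw [sliceVal, (mobC_hasSum a ha0 ha1 q hq).tsum_eq, norm_mul, norm_inv, ← div_eq_mul_inv]
  have h := mob_norm a ha0 ha1 q hq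
  rw [div_lt_one ((norm_nonneg _).trans_lt h)]
  exact h

lemma exists_a (m : ℝ) (hm0 : 0 < m) (hm1 : m ≤ 1) (r : ℝ) (hr1 : m / (2 + m) < r) (hr2 : r < 1) :
    ∃ a : ℝ, 0 < a ∧ a < 1 ∧ 1 < a ^ m + (1 - a ^ 2) * r * (1 - a * r)⁻¹ := by
  have hr0 : 0 < r := lt_trans (by positivity) hr1
  rw [div_lt_iff₀ (by positivity)] at hr1
  have hcont : Continuous fun a : ℝ => (1 + a) * r * (a + m * (1 - a)) - m * (1 - a * r) := by
    fun_prop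
  have hev : ∀ᶠ a in nhdsWithin (1 : ℝ) (Set.Iio 1),
      0 < (1 + a) * r * (a + m * (1 - a)) - m * (1 - a * r) :=
    (hcont.continuousAt.eventually_const_lt (by nlinarith)).filter_mono nhdsWithin_le_nhds
  have hev2 : ∀ᶠ a in nhdsWithin (1 : ℝ) (Set.Iio 1), a ∈ Set.Ioo (0 : ℝ) 1 :=
    Ioo_mem_nhdsLT one_pos
  obtain ⟨a, h1, ha0, ha1⟩ := (hev.and hev2).exists
  refine ⟨a, ha0, ha1, ?_⟩
  have hD : 0 < a + m * (1 - a) := by nlinarith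
  have hE : 0 < 1 - a * r := by nlinarith
  have hb := rpow_one_add_le_one_add_mul_self (s := a⁻¹ - 1)
    (by have := inv_pos.2 ha0; linarith) hm0.le hm1
  rw [add_sub_cancel, Real.inv_rpow ha0.le] at hb
  have hpow : 0 < a ^ m := Real.rpow_pos_of_pos ha0 m
  have h2 : a / (a + m * (1 - a)) ≤ a ^ m := by
    rw [inv_le_comm₀ hpow (by have := one_lt_inv₀ ha0 |>.2 ha1; nlinarith)] at hb
    have he : (1 + m * (a⁻¹ - 1))⁻¹ = a / (a + m * (1 - a)) := by
      have : 1 + m * (a⁻¹ - 1) = (a + m * (1 - a)) / a := by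
        field_simp
      rw [this, inv_div]
    rw [← he]
    exact hb
  have h3 : 1 < a / (a + m * (1 - a)) + (1 - a ^ 2) * r * (1 - a * r)⁻¹ := by
    rw [← div_eq_mul_inv, div_add_div _ _ hD.ne' hE.ne', one_lt_div (by positivity)]
    nlinarith [mul_pos (sub_pos.2 ha1) h1]
  linarith

theorem bohr_improved_sharp (m : ℝ) (hm0 : 0 < m) (hm1 : m ≤ 1)
    (N : ℕ) (hN : 1 ≤ N) (d : ℕ → ℝ) (hd : ∀ i, 1 ≤ i → i ≤ N → 0 ≤ d i)
    (hL : 8 * d 1 * Mconst m ^ 2 +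
        ∑ k ∈ Finset.Icc 2 N, 2 * (2 * (k : ℝ) - 1) * cmax k * d k * Mconst m ^ (2 * k) ≤ m)
    (r : ℝ) (hr1 : m / (2 + m) < r) (hr2 : r < 1) :
    ∃ (p : ℕ → ℍ[ℝ]) (w : ℕ → ℕ → ℍ[ℝ]) (q : ℍ[ℝ]),
      SBClass p ∧ (∀ k, 1 ≤ k → SBnClass k (w k)) ∧ ‖q‖ = r ∧
      1 < ‖p 0‖ ^ m + (∑' k : ℕ, ‖sliceVal (w (k + 1)) q‖ * ‖p (k + 1)‖) +
        ∑ i ∈ Finset.Icc 1 N, d i * Sstar p q ^ i := by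
  have hr0 : 0 < r := lt_trans (by positivity) hr1
  obtain ⟨a, ha0, ha1, ha⟩ := exists_a m hm0 hm1 r hr1 hr2
  refine ⟨mobC a, monC, (r : ℍ[ℝ]), mobC_SB a ha0 ha1, fun k hk => monC_SBn k hk, ?_, ?_⟩
  · rw [Quaternion.norm_coe, Real.norm_of_nonneg hr0.le]
  have h0 : ‖mobC a 0‖ = a := by
    simp only [mobC]
    rw [Quaternion.norm_coe, Real.norm_of_nonneg ha0.le]
  have hS : 0 ≤ Sstar (mobC a) (r : ℍ[ℝ]) := tsum_nonneg fun k => by positivity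
  have hsum : 0 ≤ ∑ i ∈ Finset.Icc 1 N, d i * Sstar (mobC a) (r : ℍ[ℝ]) ^ i := by
    refine Finset.sum_nonneg fun i hi => ?_
    rw [Finset.mem_Icc] at hi
    exact mul_nonneg (hd i hi.1 hi.2) (pow_nonneg hS i)
  have har : a * r < 1 := by nlinarith
  have ha2 : 0 < 1 - a ^ 2 := by nlinarith
  have hT : (∑' k : ℕ, ‖sliceVal (monC (k + 1)) (r : ℍ[ℝ])‖ * ‖mobC a (k + 1)‖)
      = (1 - a ^ 2) * r * (1 - a * r)⁻¹ := by
    have h := (hasSum_geometric_of_lt_one (by positivity) har).mul_left ((1 - a ^ 2) * r)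
    rw [← h.tsum_eq]
    refine tsum_congr fun k => ?_
    rw [sliceVal, (monC_hasSum (k + 1) (r : ℍ[ℝ])).tsum_eq, norm_pow]
    simp only [mobC]
    rw [Quaternion.norm_coe, Quaternion.norm_coe, Real.norm_of_nonneg hr0.le, norm_mul, norm_neg,
      Real.norm_of_nonneg ha2.le, Real.norm_of_nonneg (by positivity)]
    ring
  rw [h0, hT]
  linarith
end
end

section
/- Let m ∈ (0,1], N ≥ 1, and d₁, …, d_N ≥ 0 satisfy 8 d₁ M_m² + ∑_{k=2}^N 2(2k−1) c_k d_k M_m^{2k} ≤ m, where M_m = m(2+m)/(4(m+1)) and c_k = max_{x∈[0,1]} x(1+x)²(1−x²)^{2k−2}. Then for every t ∈ [0,1], m + 2 ∑_{k=1}^N d_k (1 − t²)^{2k−1} M_m^{2k} ≤ 2m/(1+t); equivalently, the function W(t) = m + 2 ∑_{k=1}^N d_k (1−t²)^{2k−1} M_m^{2k} − 2m/(1+t) satisfies W(t) ≤ 0 on [0,1]. -/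
theorem term_bound (n : ℕ) (C : ℝ)
    (hC : ∀ x ∈ Set.Icc (0 : ℝ) 1, x * (1 + x) ^ 2 * (1 - x ^ 2) ^ n ≤ C)
    (t : ℝ) (ht0 : 0 ≤ t) (ht1 : t ≤ 1) :
    (1 - t ^ 2) ^ (n + 1) ≤ ((n : ℝ) + 1) * C * (2 / (1 + t) - 1) := by
  have hder : ∀ x : ℝ, 0 ≤ x → HasDerivAt
      (fun x : ℝ => (1 - x ^ 2) ^ (n + 1) - ((n : ℝ) + 1) * C * 2 * (1 + x)⁻¹)
      (((n : ℝ) + 1) * (1 - x ^ 2) ^ n * (-(2 * x)) -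
        ((n : ℝ) + 1) * C * 2 * (-1 / (1 + x) ^ 2)) x := by
    intro x hx
    have h1 : HasDerivAt (fun x : ℝ => 1 - x ^ 2) (-(2 * x)) x := by
      simpa using (hasDerivAt_pow 2 x).const_sub 1
    have h2 : HasDerivAt (fun x : ℝ => 1 + x) 1 x := by
      simpa using (hasDerivAt_id x).const_add 1
    have h3 := h1.fun_pow (n + 1)
    have h4 := (h2.fun_inv (by positivity)).const_mul (((n : ℝ) + 1) * C * 2)
    have h5 := h3.fun_sub h4
    simpa using h5
  have hmono : MonotoneOn
      (fun x : ℝ => (1 - x ^ 2) ^ (n + 1) - ((n : ℝ) + 1) * C * 2 * (1 + x)⁻¹)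
      (Set.Icc 0 1) := by
    apply monotoneOn_of_deriv_nonneg (convex_Icc 0 1)
    · intro x hx
      exact (hder x hx.1).continuousAt.continuousWithinAt
    · intro x hx
      rw [interior_Icc] at hx
      exact (hder x hx.1.le).differentiableAt.differentiableWithinAt
    · intro x hx
      rw [interior_Icc] at hx
      rw [(hder x hx.1.le).deriv]
      have hx0 := hx.1
      have h := hC x ⟨hx.1.le, hx.2.le⟩
      have e : ((n : ℝ) + 1) * (1 - x ^ 2) ^ n * (-(2 * x)) -
        ((n : ℝ) + 1) * C * 2 * (-1 / (1 + x) ^ 2) =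
        2 * ((n : ℝ) + 1) / (1 + x) ^ 2 * (C - x * (1 + x) ^ 2 * (1 - x ^ 2) ^ n) := by
        have : (1 + x) ≠ 0 := by positivity
        field_simp
        ring
      rw [e]
      exact mul_nonneg (by positivity) (by linarith)
  have h := hmono ⟨ht0, ht1⟩ (Set.right_mem_Icc.2 zero_le_one) ht1
  norm_num at h
  rw [div_eq_mul_inv]
  linarith

theorem cmax_bound (k : ℕ) (x : ℝ) (hx : x ∈ Set.Icc (0 : ℝ) 1) :
    x * (1 + x) ^ 2 * (1 - x ^ 2) ^ (2 * k - 2) ≤ cmax k := by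
  apply le_csSup
  · exact (isCompact_Icc.image (by fun_prop)).bddAbove
  · exact ⟨x, hx, rfl⟩

theorem bohr_core_improved (m : ℝ) (hm0 : 0 < m) (hm1 : m ≤ 1)
    (N : ℕ) (hN : 1 ≤ N) (d : ℕ → ℝ) (hd : ∀ i, 1 ≤ i → i ≤ N → 0 ≤ d i)
    (hL : 8 * d 1 * Mconst m ^ 2 +
        ∑ k ∈ Finset.Icc 2 N, 2 * (2 * (k : ℝ) - 1) * cmax k * d k * Mconst m ^ (2 * k) ≤ m)
    (t : ℝ) (ht0 : 0 ≤ t) (ht1 : t ≤ 1) :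
    m + 2 * ∑ k ∈ Finset.Icc 1 N, d k * (1 - t ^ 2) ^ (2 * k - 1) * Mconst m ^ (2 * k) ≤
      2 * m / (1 + t) := by
  have hM : 0 ≤ Mconst m := by unfold Mconst; positivity
  have hr : 0 ≤ 2 / (1 + t) - 1 := by
    rw [sub_nonneg, le_div_iff₀ (by positivity)]; linarith
  have h1 := term_bound 0 4 (by
    rintro x ⟨h0, h1⟩
    have : x * (1 + x) ^ 2 ≤ 1 * (1 + 1) ^ 2 := by gcongr
    simp only [pow_zero]
    linarith) t ht0 ht1
  have hs : ∑ k ∈ Finset.Icc 2 N, 2 * (d k * (1 - t ^ 2) ^ (2 * k - 1) * Mconst m ^ (2 * k)) ≤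
      ∑ k ∈ Finset.Icc 2 N, (2 / (1 + t) - 1) *
        (2 * (2 * (k : ℝ) - 1) * cmax k * d k * Mconst m ^ (2 * k)) := by
    apply Finset.sum_le_sum
    intro k hk
    rw [Finset.mem_Icc] at hk
    have h := term_bound (2 * k - 2) (cmax k) (cmax_bound k) t ht0 ht1
    rw [show 2 * k - 2 + 1 = 2 * k - 1 by omega, Nat.cast_sub (by omega)] at h
    push_cast at h
    have hp : 0 ≤ 2 * (d k * Mconst m ^ (2 * k)) :=
      mul_nonneg zero_le_two (mul_nonneg (hd k (by omega) hk.2) (by positivity))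
    have := mul_le_mul_of_nonneg_left h hp
    linarith
  have hp1 : 0 ≤ 2 * (d 1 * Mconst m ^ 2) :=
    mul_nonneg zero_le_two (mul_nonneg (hd 1 le_rfl hN) (by positivity))
  have h1' := mul_le_mul_of_nonneg_left h1 hp1
  have hLr := mul_le_mul_of_nonneg_left hL hr
  rw [mul_add, Finset.mul_sum] at hLr
  rw [Finset.mul_sum, ← Finset.add_sum_Ioc_eq_sum_Icc hN,
    show Finset.Ioc 1 N = Finset.Icc 2 N by ext; simp [Finset.mem_Ioc, Finset.mem_Icc]; omega]
  rw [mul_div_right_comm]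
  norm_num at h1' ⊢
  linarith
end
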